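/- Let the Rényi entropy functions h_α : [0,1] → [0,1] be defined by h_α(λ) := (1−α)^{-1} log₂[λ^α + (1−λ)^α] for α ∈ (0,∞) \ {1} and h₁(λ) := −λ log₂ λ − (1−λ) log₂(1−λ). Then for every d ∈ ℕ and every α > 0: h_α belongs to the class ℍ_d if and only if α > 1/d. -/

import Mathlib

open MeasureTheory Filter Topology Complex Pointwise Asymptotics
open scoped ENNReal NNReal SchwartzMap

noncomputable section

/-- `h : [0,1] → ℂ` is piecewise continuous: continuous on `[0,1]` off a finite set. -/
def PiecewiseContinuousOn01 (h : ℝ → ℂ) : Prop :=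
  ∃ S : Finset ℝ, ∀ x ∈ Set.Icc (0:ℝ) 1, x ∉ S → ContinuousWithinAt h (Set.Icc (0:ℝ) 1) x

/-- The test function class `ℍ_d` of the paper.  For `d ≥ 2`: piecewise continuous
`h : [0,1] → ℂ` with `h(0) = 0` and `h(λ) = O(λ^α)`, `h(1) - h(1-λ) = O(λ^α)` as `λ ↘ 0` for
some `α > 1/d`.  For `d = 1`: piecewise continuous `h` with `h(0) = 0`, symmetric about `1/2`,
and `h(λ) = o(λ ln λ)` as `λ ↘ 0`. -/
def MemTestClass (d : ℕ) (h : ℝ → ℂ) : Prop :=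
  if d = 1 then
    PiecewiseContinuousOn01 h ∧ h 0 = 0 ∧ (∀ l ∈ Set.Icc (0:ℝ) 1, h l = h (1 - l)) ∧
      h =o[nhdsWithin (0:ℝ) (Set.Ioi 0)] fun l => l * Real.log l
  else
    PiecewiseContinuousOn01 h ∧ h 0 = 0 ∧
      ∃ α : ℝ, 1 / (d : ℝ) < α ∧ (h =O[nhdsWithin (0:ℝ) (Set.Ioi 0)] fun l => l ^ α) ∧
        ((fun l => h 1 - h (1 - l)) =O[nhdsWithin (0:ℝ) (Set.Ioi 0)] fun l => l ^ α)

/-- The Rényi entropy functions `h_α` (with `h₁` the von Neumann entropy function and the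
convention `0 log₂ 0 = 0`, which is automatic for `Real.logb`). -/
def renyiEntropyFn (α : ℝ) : ℝ → ℝ := fun l =>
  if α = 1 then -(l * Real.logb 2 l) - (1 - l) * Real.logb 2 (1 - l)
  else (1 - α)⁻¹ * Real.logb 2 (l ^ α + (1 - l) ^ α)

/-- Higher powers are negligible against lower ones as the base tends to `0` from the right. -/
theorem isLittleO_rpow_rpow_nhdsGT_zero {p q : ℝ} (h : p < q) :
    (fun l : ℝ => l ^ q) =o[𝓝[>] 0] fun l => l ^ p := by
  have hpos : ∀ᶠ l : ℝ in 𝓝[>] 0, 0 < l := eventually_mem_nhdsWithin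
  refine (isLittleO_iff_tendsto' (hpos.mono fun l hl h0 =>
    absurd h0 (Real.rpow_pos_of_pos hl p).ne')).2 ?_
  have ht : Tendsto (fun l : ℝ => l ^ (q - p)) (𝓝[>] 0) (𝓝 0) := by
    have := (Real.continuousAt_rpow_const 0 (q - p) (Or.inr (sub_pos.2 h).le)).tendsto
    rw [Real.zero_rpow (sub_pos.2 h).ne'] at this
    exact this.mono_left nhdsWithin_le_nhds
  exact ht.congr' (hpos.mono fun l hl => Real.rpow_sub hl q p)

theorem isLittleO_mul_log_rpow_nhdsGT_zero {p : ℝ} (h : p < 1) :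
    (fun l : ℝ => l * Real.log l) =o[𝓝[>] 0] fun l => l ^ p := by
  have hlog : Real.log =o[𝓝[>] 0] fun l : ℝ => l ^ (p - 1) :=
    isLittleO_log_rpow_nhdsGT_zero (sub_neg.2 h)
  refine ((isBigO_refl (fun l : ℝ => l) _).mul_isLittleO hlog).congr' .rfl ?_
  filter_upwards [self_mem_nhdsWithin] with l (hl : 0 < l)
  rw [Real.rpow_sub_one hl.ne', mul_div_cancel₀ _ hl.ne']

theorem isLittleO_id_mul_log_nhdsGT_zero :
    (fun l : ℝ => l) =o[𝓝[>] 0] fun l => l * Real.log l := by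
  have hlog : (fun _ : ℝ => (1 : ℝ)) =o[𝓝[>] 0] Real.log :=
    isLittleO_const_left.2 <| Or.inr <|
      tendsto_abs_atBot_atTop.comp Real.tendsto_log_nhdsGT_zero
  simpa using (isBigO_refl (fun l : ℝ => l) _).mul_isLittleO hlog

theorem frequently_rpow_ne_zero_nhdsGT_zero (p : ℝ) :
    ∃ᶠ l : ℝ in 𝓝[>] 0, l ^ p ≠ 0 := by
  have hpos : ∀ᶠ l : ℝ in 𝓝[>] 0, 0 < l := eventually_mem_nhdsWithin
  exact (hpos.mono fun l hl => (Real.rpow_pos_of_pos hl p).ne').frequently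

theorem tendsto_one_sub_nhdsGT_zero : Tendsto (fun l : ℝ => 1 - l) (𝓝[>] 0) (𝓝 1) := by
  have : Tendsto (fun l : ℝ => 1 - l) (𝓝 0) (𝓝 (1 - 0)) :=
    (continuous_const.sub continuous_id).tendsto 0
  rw [sub_zero] at this
  exact this.mono_left nhdsWithin_le_nhds

theorem isBigO_comp_one_sub_nhdsGT_zero {f : ℝ → ℝ} (hf : DifferentiableAt ℝ f 1) :
    (fun l : ℝ => f (1 - l) - f 1) =O[𝓝[>] 0] fun l => l := by
  have := (hf.isBigO_sub.comp_tendsto tendsto_one_sub_nhdsGT_zero).neg_right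
  simpa [Function.comp_def] using this

theorem renyiEntropyFn_one_sub (α l : ℝ) : renyiEntropyFn α (1 - l) = renyiEntropyFn α l := by
  unfold renyiEntropyFn
  rw [sub_sub_cancel, add_comm]
  split_ifs <;> ring

theorem renyiEntropyFn_zero {α : ℝ} (hα : 0 < α) : renyiEntropyFn α 0 = 0 := by
  simp [renyiEntropyFn, Real.zero_rpow hα.ne']

theorem continuousOn_renyiEntropyFn {α : ℝ} (hα : 0 < α) :
    ContinuousOn (renyiEntropyFn α) (Set.Icc 0 1) := by
  by_cases h1 : α = 1
  · have hc : Continuous fun l : ℝ => l * Real.logb 2 l := by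
      simpa [Real.logb, mul_div_assoc] using Real.continuous_mul_log.div_const (Real.log 2)
    have hc' : Continuous fun l : ℝ => (1 - l) * Real.logb 2 (1 - l) :=
      hc.comp (continuous_const.sub continuous_id)
    exact (hc.neg.sub hc').continuousOn.congr fun l _ => by simp [renyiEntropyFn, h1]
  · have hsum : Continuous fun l : ℝ => l ^ α + (1 - l) ^ α :=
      (Real.continuous_rpow_const hα.le).add
        ((Real.continuous_rpow_const hα.le).comp (continuous_const.sub continuous_id))
    have hne : ∀ l ∈ Set.Icc (0 : ℝ) 1, l ^ α + (1 - l) ^ α ≠ 0 := by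
      rintro l ⟨h0, hl⟩
      rcases h0.eq_or_lt with rfl | h0
      · simp [Real.zero_rpow hα.ne']
      · exact (add_pos_of_pos_of_nonneg (Real.rpow_pos_of_pos h0 α)
          (Real.rpow_nonneg (sub_nonneg.2 hl) α)).ne'
    exact (((hsum.continuousOn.log hne).div_const (Real.log 2)).const_mul (1 - α)⁻¹).congr
      fun l _ => by simp [renyiEntropyFn, h1, Real.logb]

/-- Near `0` the Rényi entropy function with `α ≠ 1` has the order of `l ^ α + (1 - l) ^ α - 1`. -/
theorem renyiEntropyFn_isTheta {α : ℝ} (hα : 0 < α) (h1 : α ≠ 1) :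
    renyiEntropyFn α =Θ[𝓝[>] 0] fun l => l ^ α + ((1 - l) ^ α - 1) := by
  have ht : Tendsto (fun l : ℝ => l ^ α + (1 - l) ^ α) (𝓝[>] 0) (𝓝 1) := by
    have h0 := (Real.continuous_rpow_const hα.le).tendsto 0
    have h1 := ((Real.continuous_rpow_const hα.le).tendsto 1).comp tendsto_one_sub_nhdsGT_zero
    simpa [Real.zero_rpow hα.ne'] using (h0.mono_left nhdsWithin_le_nhds).add h1
  have hlog : Real.log ~[𝓝 1] fun u => u - 1 := by
    have := (Real.hasDerivAt_log one_ne_zero).isLittleO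
    simpa [IsEquivalent, Pi.sub_def] using this
  have hcomp := (hlog.comp_tendsto ht).isTheta
  have hc : (1 - α)⁻¹ * (Real.log 2)⁻¹ ≠ 0 :=
    mul_ne_zero (inv_ne_zero (sub_ne_zero.2 h1.symm))
      (inv_ne_zero (Real.log_pos one_lt_two).ne')
  refine (EventuallyEq.trans_isTheta ?_ ((isTheta_const_mul_left hc).2 hcomp)).trans_eventuallyEq ?_
  · filter_upwards with l
    simp only [renyiEntropyFn, if_neg h1, Real.logb, Function.comp_apply]
    ring
  · filter_upwards with l
    simp only [Function.comp_apply]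
    ring

theorem one_sub_rpow_sub_one_isBigO (α : ℝ) :
    (fun l : ℝ => (1 - l) ^ α - 1) =O[𝓝[>] 0] fun l => l := by
  simpa using isBigO_comp_one_sub_nhdsGT_zero
    (Real.differentiableAt_rpow_const_of_ne α one_ne_zero)

theorem renyiEntropyFn_isTheta_of_lt_one {α : ℝ} (hα : 0 < α) (h1 : α < 1) :
    renyiEntropyFn α =Θ[𝓝[>] 0] fun l => l ^ α := by
  have hid : (fun l : ℝ => l) =o[𝓝[>] 0] fun l => l ^ α := by
    simpa using isLittleO_rpow_rpow_nhdsGT_zero h1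
  exact (renyiEntropyFn_isTheta hα h1.ne).trans
    (IsEquivalent.refl.add_isLittleO ((one_sub_rpow_sub_one_isBigO α).trans_isLittleO hid)).isTheta

theorem renyiEntropyFn_isBigO_of_one_lt {α : ℝ} (h1 : 1 < α) :
    renyiEntropyFn α =O[𝓝[>] 0] fun l => l := by
  have hpow : (fun l : ℝ => l ^ α) =O[𝓝[>] 0] fun l => l := by
    simpa using (isLittleO_rpow_rpow_nhdsGT_zero h1).isBigO
  exact (renyiEntropyFn_isTheta (one_pos.trans h1) h1.ne').isBigO.trans
    (hpow.add (one_sub_rpow_sub_one_isBigO α))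

theorem renyiEntropyFn_one_isTheta :
    renyiEntropyFn 1 =Θ[𝓝[>] 0] fun l => l * Real.log l := by
  have hrest : (fun l : ℝ => (1 - l) * Real.log (1 - l)) =O[𝓝[>] 0] fun l => l := by
    have hd : DifferentiableAt ℝ (fun l : ℝ => l * Real.log l) 1 :=
      differentiableAt_id.mul (Real.differentiableAt_log one_ne_zero)
    simpa using isBigO_comp_one_sub_nhdsGT_zero hd
  have hsum := (IsEquivalent.refl.add_isLittleO
    (hrest.trans_isLittleO isLittleO_id_mul_log_nhdsGT_zero)).isTheta
  have hc : -(Real.log 2)⁻¹ ≠ 0 := neg_ne_zero.2 (inv_ne_zero (Real.log_pos one_lt_two).ne')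
  refine EventuallyEq.trans_isTheta ?_ ((isTheta_const_mul_left hc).2 hsum)
  filter_upwards with l
  simp only [renyiEntropyFn, if_true, Real.logb, Pi.add_apply]
  ring

theorem renyiEntropyFn_isLittleO_mul_log_iff {α : ℝ} (hα : 0 < α) :
    (renyiEntropyFn α =o[𝓝[>] 0] fun l => l * Real.log l) ↔ 1 < α := by
  refine ⟨fun h => ?_, fun h =>
    (renyiEntropyFn_isBigO_of_one_lt h).trans_isLittleO isLittleO_id_mul_log_nhdsGT_zero⟩
  by_contra! hle
  rcases hle.lt_or_eq with hlt | rfl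
  · exact isLittleO_irrefl (frequently_rpow_ne_zero_nhdsGT_zero α)
      (((renyiEntropyFn_isTheta_of_lt_one hα hlt).isBigO_symm.trans_isLittleO h).trans
        (isLittleO_mul_log_rpow_nhdsGT_zero hlt))
  · have hself := renyiEntropyFn_one_isTheta.isBigO_symm.trans_isLittleO h
    refine isLittleO_irrefl (Filter.Eventually.frequently ?_) hself
    filter_upwards [Ioo_mem_nhdsGT (zero_lt_one (α := ℝ))] with l hl
    exact mul_ne_zero hl.1.ne' (Real.log_neg hl.1 hl.2).ne

theorem exists_renyiEntropyFn_isBigO_rpow_iff {α c : ℝ} (hα : 0 < α) (hc : c < 1) :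
    (∃ β, c < β ∧ renyiEntropyFn α =O[𝓝[>] 0] fun l => l ^ β) ↔ c < α := by
  constructor
  · rintro ⟨β, hβ, h⟩
    by_contra! hle
    exact isLittleO_irrefl (frequently_rpow_ne_zero_nhdsGT_zero α)
      (((renyiEntropyFn_isTheta_of_lt_one hα (hle.trans_lt hc)).isBigO_symm.trans h).trans_isLittleO
        (isLittleO_rpow_rpow_nhdsGT_zero (hle.trans_lt hβ)))
  · intro h
    rcases lt_trichotomy α 1 with h1 | rfl | h1
    · exact ⟨α, h, (renyiEntropyFn_isTheta_of_lt_one hα h1).isBigO⟩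
    · obtain ⟨β, hcβ, hβ⟩ := exists_between hc
      exact ⟨β, hcβ, renyiEntropyFn_one_isTheta.isBigO.trans
        (isLittleO_mul_log_rpow_nhdsGT_zero hβ).isBigO⟩
    · exact ⟨1, hc, by simpa using renyiEntropyFn_isBigO_of_one_lt h1⟩

/-- **Membership of the Rényi entropy functions in the test function class**:
for every `d ≥ 1` and `α > 0`, `h_α ∈ ℍ_d` if and only if `α > 1/d`. -/
theorem renyi_mem_test_class_iff
    (d : ℕ) (hd : 0 < d) (α : ℝ) (hα : 0 < α) :
    MemTestClass d (fun l => ((renyiEntropyFn α l : ℝ) : ℂ)) ↔ 1 / (d : ℝ) < α := by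
  have hpc : PiecewiseContinuousOn01 (fun l => ((renyiEntropyFn α l : ℝ) : ℂ)) :=
    ⟨∅, fun x hx _ =>
      (continuous_ofReal.comp_continuousOn (continuousOn_renyiEntropyFn hα)) x hx⟩
  have h0 : ((renyiEntropyFn α 0 : ℝ) : ℂ) = 0 := by simp [renyiEntropyFn_zero hα]
  have h1 : renyiEntropyFn α 1 = 0 := by
    simpa [renyiEntropyFn_zero hα] using renyiEntropyFn_one_sub α 0
  unfold MemTestClass
  split_ifs with hd1
  · subst hd1
    rw [Nat.cast_one, div_one, ← renyiEntropyFn_isLittleO_mul_log_iff hα]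
    refine ⟨fun h => Complex.isLittleO_ofReal_left.1 h.2.2.2, fun h => ⟨hpc, h0, fun l _ => ?_, ?_⟩⟩
    · simp only [renyiEntropyFn_one_sub]
    · exact Complex.isLittleO_ofReal_left.2 h
  · have hc : 1 / (d : ℝ) < 1 := by
      have : (1 : ℝ) < d := by exact_mod_cast (by omega : 1 < d)
      exact (div_lt_one (one_pos.trans this)).2 this
    rw [← exists_renyiEntropyFn_isBigO_rpow_iff hα hc]
    constructor
    · rintro ⟨-, -, β, hβ, hO, -⟩
      exact ⟨β, hβ, Complex.isBigO_ofReal_left.1 hO⟩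
    · rintro ⟨β, hβ, hO⟩
      have hO' := Complex.isBigO_ofReal_left.2 hO
      refine ⟨hpc, h0, β, hβ, hO', ?_⟩
      simpa [h1, renyiEntropyFn_one_sub] using hO'
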